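/- (Cartan–Dieudonné theorem) Every orthogonal transformation T of ℝ^{p,q} is the composition of at most p+q reflections with respect to hyperplanes: there exist k ≤ p+q and invertible vectors s_1, …, s_k such that T = φ_{s_1} ∘ φ_{s_2} ∘ ⋯ ∘ φ_{s_k} (where the empty composition is the identity). -/

import Mathlib

/-- The standard bilinear form of signature `(p, q)` on `ℝ^(p+q)`:
`B x y = ∑_{i < p} x i * y i - ∑_{p ≤ i < p+q} x i * y i`. -/
noncomputable def Bpq (p q : ℕ) : LinearMap.BilinForm ℝ (Fin (p + q) → ℝ) :=
  LinearMap.mk₂ ℝ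
    (fun x y => ∑ i : Fin (p + q), (if i.val < p then (1 : ℝ) else -1) * (x i * y i))
    (fun x x' y => by simp [add_mul, mul_add, Finset.sum_add_distrib])
    (fun c x y => by simp [Finset.mul_sum]; congr 1; funext i; ring_nf)
    (fun x y y' => by simp [add_mul, mul_add, Finset.sum_add_distrib])
    (fun c x y => by simp [Finset.mul_sum]; congr 1; funext i; ring_nf)

/-- The reflection with respect to the hyperplane orthogonal to `s`:
`φ_s x = x - (2 * B x s / B s s) • s`. -/
noncomputable def reflpq (p q : ℕ) (s x : Fin (p + q) → ℝ) : Fin (p + q) → ℝ :=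
  x - (2 * Bpq p q x s / Bpq p q s s) • s

open Module

namespace CD

variable {V : Type*} [AddCommGroup V] [Module ℝ V] [FiniteDimensional ℝ V]

/-- Reflection as a linear map. -/
noncomputable def refl (B : LinearMap.BilinForm ℝ V) (s : V) : V →ₗ[ℝ] V :=
  LinearMap.transvection ((-2 / B s s) • B s) s

theorem refl_apply (B : LinearMap.BilinForm ℝ V) (s x : V) :
    refl B s x = x + ((-2 / B s s) * B s x) • s := by
  simp [refl, LinearMap.transvection.apply]

theorem refl_det (B : LinearMap.BilinForm ℝ V) (s : V) (hs : B s s ≠ 0) :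
    LinearMap.det (refl B s) = -1 := by
  rw [refl, LinearMap.transvection.det]
  simp
  field_simp
  norm_num

theorem refl_isom (B : LinearMap.BilinForm ℝ V) (hsym : ∀ x y, B x y = B y x) (s : V)
    (hs : B s s ≠ 0) (x y : V) : B (refl B s x) (refl B s y) = B x y := by
  simp only [refl_apply, map_add, map_smul, LinearMap.add_apply, LinearMap.smul_apply,
    smul_eq_mul]
  rw [hsym x s]
  field_simp
  ring

theorem refl_refl (B : LinearMap.BilinForm ℝ V) (s : V) (hs : B s s ≠ 0) :
    refl B s * refl B s = 1 := by
  have hself : refl B s s = -s := by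
    rw [refl_apply, div_mul_cancel₀ _ hs]
    module
  ext x
  rw [Module.End.mul_apply, refl_apply B s x, map_add, map_smul, hself, refl_apply B s x,
    Module.End.one_apply]
  module

theorem refl_fix (B : LinearMap.BilinForm ℝ V) (s x : V) (h : B s x = 0) :
    refl B s x = x := by
  simp [refl_apply, h]

theorem refl_sub (B : LinearMap.BilinForm ℝ V) (hsym : ∀ x y, B x y = B y x) (a b : V)
    (hab : B a a = B b b) (h : B (b - a) (b - a) ≠ 0) : refl B (b - a) b = a := by
  have h1 : (-2 / B (b - a) (b - a)) * B (b - a) b = -1 := by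
    have : B (b - a) (b - a) = 2 * B (b - a) b := by
      simp only [map_sub, LinearMap.sub_apply]
      rw [hab, hsym b a]; ring
    rw [div_mul_eq_mul_div, div_eq_iff h, this]; ring
  rw [refl_apply, h1]; simp

/-- product of reflections -/
def IsProd (B : LinearMap.BilinForm ℝ V) (T : V →ₗ[ℝ] V) (k : ℕ) : Prop :=
  ∃ l : List V, l.length = k ∧ (∀ s ∈ l, B s s ≠ 0) ∧ T = (l.map (refl B)).prod

theorem IsProd.det {B : LinearMap.BilinForm ℝ V} {T : V →ₗ[ℝ] V} {k : ℕ} (h : IsProd B T k) :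
    LinearMap.det T = (-1) ^ k := by
  obtain ⟨l, rfl, hl, rfl⟩ := h
  induction l with
  | nil => simp
  | cons a l ih =>
    simp only [List.map_cons, List.prod_cons, List.length_cons, map_mul]
    rw [ih (fun s hs => hl s (by simp [hs])), refl_det B a (hl a (by simp))]
    ring

theorem IsProd.cons {B : LinearMap.BilinForm ℝ V} {T : V →ₗ[ℝ] V} {k : ℕ} (s : V)
    (hs : B s s ≠ 0) (h : IsProd B (refl B s * T) k) : IsProd B T (k + 1) := by
  obtain ⟨l, rfl, hl, h⟩ := h
  refine ⟨s :: l, rfl, by simpa [hs] using hl, ?_⟩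
  rw [List.map_cons, List.prod_cons, ← h, ← mul_assoc, refl_refl B s hs, one_mul]

theorem isom_inj (B : LinearMap.BilinForm ℝ V) (hnd : B.Nondegenerate) (T : V →ₗ[ℝ] V)
    (hT : ∀ x y, B (T x) (T y) = B x y) : Function.Injective T := by
  rw [injective_iff_map_eq_zero]
  intro x hx
  apply hnd.1
  intro y
  rw [← hT, hx]; simp

theorem bad_case (B : LinearMap.BilinForm ℝ V) (hsym : ∀ x y, B x y = B y x)
    (hnd : B.Nondegenerate) (F : Submodule ℝ V) (hF : Disjoint F (B.orthogonal F))
    (T : V →ₗ[ℝ] V) (hT : ∀ x y, B (T x) (T y) = B x y) (hfix : ∀ x ∈ F, T x = x)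
    (c : V) (hc : c ∈ B.orthogonal F) (hcc : B c c ≠ 0)
    (hall : ∀ a ∈ B.orthogonal F, B a a ≠ 0 → T a ≠ a ∧ B (T a - a) (T a - a) = 0) :
    0 < LinearMap.det T ∧ ∃ m, finrank ℝ V = finrank ℝ F + 2 * m := by
  have hrefl : B.IsRefl := fun x y h => by rw [hsym]; exact h
  have hcompl := (LinearMap.BilinForm.isCompl_orthogonal_iff_disjoint hrefl).2 hF
  have hinj := isom_inj B hnd T hT
  have hsurj : Function.Surjective T := LinearMap.injective_iff_surjective.1 hinj
  obtain ⟨N, hN⟩ : ∃ N : V →ₗ[ℝ] V, T = 1 + N := ⟨T - 1, by simp⟩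
  have hTN : ∀ x, T x = x + N x := fun x => by simp [hN]
  have hTs : ∀ x, T x - x = N x := fun x => by simp [hN]
  simp only [hTs] at hall
  have q1 : ∀ a ∈ B.orthogonal F, B (N a) (N a) = 0 := by
    intro a ha
    by_cases haa : B a a = 0
    · have key : ∀ t : ℝ, t ≠ 0 → 2 * B a c + t * B c c ≠ 0 →
          B (N a) (N a) + 2 * t * B (N a) (N c) = 0 := by
        intro t ht h
        have h1 : B (a + t • c) (a + t • c) ≠ 0 := by
          have : B (a + t • c) (a + t • c) = t * (2 * B a c + t * B c c) := by
            simp only [map_add, map_smul, LinearMap.add_apply, LinearMap.smul_apply,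
              smul_eq_mul, haa, hsym c a]
            ring
          rw [this]; exact mul_ne_zero ht h
        have h2 := (hall _ (Submodule.add_mem _ ha (Submodule.smul_mem _ t hc)) h1).2
        have h3 := (hall c hc hcc).2
        simp only [map_add, map_smul, LinearMap.add_apply, LinearMap.smul_apply,
              smul_eq_mul, hsym (N c) (N a), h3] at h2
        linarith
      by_cases hac : B a c = 0
      · have k1 := key 1 one_ne_zero (by simpa [hac] using hcc)
        have k2 := key (-1) (by norm_num) (by simpa [hac] using hcc)
        linarith
      · have k1 := key (2 * B a c / B c c) (by positivity) (by
          rw [div_mul_cancel₀ _ hcc]; intro h; apply hac; linarith)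
        have k2 := key (4 * B a c / B c c) (by positivity) (by
          rw [div_mul_cancel₀ _ hcc]; intro h; apply hac; linarith)
        have : 4 * B a c / B c c = 2 * (2 * B a c / B c c) := by ring
        rw [this] at k2
        linarith
    · exact (hall a ha haa).2
  have dec : ∀ x : V, ∃ f ∈ F, ∃ w ∈ B.orthogonal F, f + w = x := by
    intro x
    have : x ∈ F ⊔ B.orthogonal F := by rw [hcompl.sup_eq_top]; trivial
    exact Submodule.mem_sup.1 this
  have hNF : ∀ f ∈ F, N f = 0 := by
    intro f hf
    rw [← hTs, hfix f hf, sub_self]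
  have q2 : ∀ x, B (N x) (N x) = 0 := by
    intro x
    obtain ⟨f, hf, w, hw, rfl⟩ := dec x
    rw [map_add, hNF f hf, zero_add]
    exact q1 w hw
  have q3 : ∀ x y, B (N x) (N y) = 0 := by
    intro x y
    have h := q2 (x + y)
    simp only [map_add, LinearMap.add_apply, q2, hsym (N y) (N x)] at h
    linarith
  have hNN : ∀ x, N (N x) = 0 := by
    intro x
    apply hnd.1
    intro y
    obtain ⟨w, rfl⟩ := hsurj y
    have h1 := hT (N x) w
    rw [hTN (N x), map_add, LinearMap.add_apply, hTN w, map_add, q3] at h1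
    rw [hTN w]
    linarith
  constructor
  · have hsq : T = (1 + (1 / 2 : ℝ) • N) * (1 + (1 / 2 : ℝ) • N) := by
      ext x
      simp only [hTN, Module.End.mul_apply, LinearMap.add_apply, LinearMap.smul_apply,
        Module.End.one_apply, map_add, map_smul, hNN]
      module
    have hne : LinearMap.det T ≠ 0 := by
      intro h
      have := LinearMap.bot_lt_ker_of_det_eq_zero h
      rw [LinearMap.ker_eq_bot.2 hinj] at this
      exact lt_irrefl _ this
    have hge : 0 ≤ LinearMap.det T := by
      rw [hsq, map_mul]; exact mul_self_nonneg _
    exact lt_of_le_of_ne hge hne.symm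
  · set W := B.orthogonal F with hW
    set K := W ⊓ LinearMap.ker N with hK
    have hNW : ∀ x, N x ∈ W := by
      intro x
      rw [hW, LinearMap.BilinForm.mem_orthogonal_iff]
      intro f hf
      have h1 := hT f x
      rw [hfix f hf, hTN, map_add] at h1
      linarith
    have k0 : ∀ x ∈ K, B x x = 0 := by
      intro x hx
      by_contra h
      have := (hall x hx.1 h).1
      apply this
      rw [hTN, LinearMap.mem_ker.1 hx.2, add_zero]
    have k1 : ∀ x ∈ K, ∀ y ∈ K, B x y = 0 := by
      intro x hx y hy
      have h := k0 _ (K.add_mem hx hy)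
      simp only [map_add, LinearMap.add_apply, k0 x hx, k0 y hy, hsym y x] at h
      linarith
    have d1 : finrank ℝ W = finrank ℝ V - finrank ℝ F :=
      LinearMap.BilinForm.finrank_orthogonal hnd F
    have d2 : finrank ℝ (B.orthogonal K) = finrank ℝ V - finrank ℝ K :=
      LinearMap.BilinForm.finrank_orthogonal hnd K
    have d3 := LinearMap.finrank_range_add_finrank_ker (N.domRestrict W)
    have d4 : finrank ℝ (LinearMap.range (N.domRestrict W)) ≤ finrank ℝ K := by
      apply Submodule.finrank_mono
      rintro _ ⟨x, rfl⟩
      exact ⟨hNW _, hNN _⟩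
    have d5 : finrank ℝ (LinearMap.ker (N.domRestrict W)) ≤ finrank ℝ K := by
      rw [← Submodule.finrank_map_subtype_eq]
      apply Submodule.finrank_mono
      rintro _ ⟨x, hx, rfl⟩
      exact ⟨x.2, hx⟩
    have d6 : finrank ℝ (K ⊔ F : Submodule ℝ V) ≤ finrank ℝ (B.orthogonal K) := by
      apply Submodule.finrank_mono
      apply sup_le
      · intro x hx
        rw [LinearMap.BilinForm.mem_orthogonal_iff]
        intro y hy
        exact k1 y hy x hx
      · intro x hx
        rw [LinearMap.BilinForm.mem_orthogonal_iff]
        intro y hy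
        rw [hsym]
        exact hy.1 x hx
    have d7 := Submodule.finrank_sup_add_finrank_inf_eq K F
    have d8 : K ⊓ F = ⊥ := by
      rw [eq_bot_iff]
      rintro x ⟨hx, hxF⟩
      exact hF.le_bot ⟨hxF, hx.1⟩
    rw [d8, finrank_bot] at d7
    have d9 := Submodule.finrank_le F
    have d10 := Submodule.finrank_le K
    exact ⟨finrank ℝ K, by omega⟩

theorem main (B : LinearMap.BilinForm ℝ V) (hsym : ∀ x y, B x y = B y x)
    (hnd : B.Nondegenerate) (n : ℕ) : ∀ (F : Submodule ℝ V), Disjoint F (B.orthogonal F) →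
    finrank ℝ V - finrank ℝ F ≤ n →
    ∀ (T : V →ₗ[ℝ] V), (∀ x y, B (T x) (T y) = B x y) → (∀ x ∈ F, T x = x) →
    ∃ k, k + finrank ℝ F ≤ finrank ℝ V ∧ IsProd B T k := by
  induction n with
  | zero =>
    intro F hF hd T hT hfix
    have : F = ⊤ := Submodule.eq_top_of_finrank_eq (by have := Submodule.finrank_le F; omega)
    refine ⟨0, by simpa using Submodule.finrank_le F, [], rfl, by simp, ?_⟩
    ext x
    simpa using hfix x (by simp [this])
  | succ n ih =>
    intro F hF hd T hT hfix
    have hrefl : B.IsRefl := fun x y h => by rw [hsym]; exact h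
    have hcompl := (LinearMap.BilinForm.isCompl_orthogonal_iff_disjoint hrefl).2 hF
    have dec : ∀ x : V, ∃ f ∈ F, ∃ w ∈ B.orthogonal F, f + w = x := by
      intro x
      have : x ∈ F ⊔ B.orthogonal F := by rw [hcompl.sup_eq_top]; trivial
      exact Submodule.mem_sup.1 this
    -- a fixed nonisotropic vector
    have step1 : ∀ T : V →ₗ[ℝ] V, (∀ x y, B (T x) (T y) = B x y) → (∀ x ∈ F, T x = x) →
        ∀ a ∈ B.orthogonal F, B a a ≠ 0 → T a = a →
        ∃ k, k + finrank ℝ F + 1 ≤ finrank ℝ V ∧ IsProd B T k := by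
      intro T hT hfix a ha haa hTa
      have hlt : F < F ⊔ ℝ ∙ a := by
        refine lt_of_le_of_ne le_sup_left ?_
        intro h
        have haF : a ∈ F := by
          rw [h]; exact Submodule.mem_sup_right (Submodule.mem_span_singleton_self a)
        exact haa (ha a haF)
      have hlt' := Submodule.finrank_lt_finrank_of_lt hlt
      obtain ⟨k, hk, hp⟩ := ih (F ⊔ ℝ ∙ a) (by
        rw [Submodule.disjoint_def]
        intro x hx hx'
        obtain ⟨f, hf, w, hw, rfl⟩ := Submodule.mem_sup.1 hx
        obtain ⟨t, rfl⟩ := Submodule.mem_span_singleton.1 hw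
        have h1 := hx' a (Submodule.mem_sup_right (Submodule.mem_span_singleton_self a))
        have h2 : B a f = 0 := by rw [hsym]; exact ha f hf
        have ht : t = 0 := by
          simpa [h2, haa] using h1
        subst ht
        rw [zero_smul, add_zero] at hx' ⊢
        apply (Submodule.disjoint_def.1 hF) f hf
        intro g hg
        exact hx' g (Submodule.mem_sup_left hg)) (by omega) T hT (by
        intro x hx
        obtain ⟨f, hf, w, hw, rfl⟩ := Submodule.mem_sup.1 hx
        obtain ⟨t, rfl⟩ := Submodule.mem_span_singleton.1 hw
        rw [map_add, map_smul, hTa, hfix f hf])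
      exact ⟨k, by omega, hp⟩
    have isomul : ∀ T : V →ₗ[ℝ] V, (∀ x y, B (T x) (T y) = B x y) → ∀ s, B s s ≠ 0 →
        ∀ x y, B ((refl B s * T) x) ((refl B s * T) y) = B x y := by
      intro T hT s hs x y
      rw [Module.End.mul_apply, Module.End.mul_apply, refl_isom B hsym s hs, hT]
    have fixmul : ∀ T : V →ₗ[ℝ] V, (∀ x ∈ F, T x = x) → ∀ s ∈ B.orthogonal F,
        ∀ x ∈ F, (refl B s * T) x = x := by
      intro T hfix s hs x hx
      rw [Module.End.mul_apply, hfix x hx, refl_fix]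
      rw [hsym]; exact hs x hx
    have step2 : ∀ T : V →ₗ[ℝ] V, (∀ x y, B (T x) (T y) = B x y) → (∀ x ∈ F, T x = x) →
        ∀ a ∈ B.orthogonal F, B a a ≠ 0 → ¬ (T a ≠ a ∧ B (T a - a) (T a - a) = 0) →
        ∃ k, k + finrank ℝ F ≤ finrank ℝ V ∧ IsProd B T k := by
      intro T hT hfix a ha haa h
      by_cases hTa : T a = a
      · obtain ⟨k, hk, hp⟩ := step1 T hT hfix a ha haa hTa
        exact ⟨k, by omega, hp⟩
      · have hs : B (T a - a) (T a - a) ≠ 0 := fun h' => h ⟨hTa, h'⟩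
        have hsW : T a - a ∈ B.orthogonal F := by
          refine Submodule.sub_mem _ ?_ ha
          intro f hf
          have := hT f a
          rw [hfix f hf] at this
          exact this.trans (ha f hf)
        obtain ⟨k, hk, hp⟩ := step1 (refl B (T a - a) * T) (isomul T hT _ hs)
          (fixmul T hfix _ hsW) a ha haa
          (by rw [Module.End.mul_apply]; exact refl_sub B hsym a (T a) (hT a a).symm hs)
        exact ⟨k + 1, by omega, hp.cons _ hs⟩
    by_cases hex : ∃ c ∈ B.orthogonal F, B c c ≠ 0
    · obtain ⟨c, hc, hcc⟩ := hex
      by_cases hbad : ∀ a ∈ B.orthogonal F, B a a ≠ 0 → T a ≠ a ∧ B (T a - a) (T a - a) = 0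
      · obtain ⟨hdet, m, hm⟩ := bad_case B hsym hnd F hF T hT hfix c hc hcc hbad
        have hdet' : LinearMap.det (refl B c * T) = - LinearMap.det T := by
          rw [map_mul, refl_det B c hcc]; ring
        have h1 := isomul T hT c hcc
        have h2 := fixmul T hfix c hc
        have hgood : ¬ ∀ a ∈ B.orthogonal F, B a a ≠ 0 → (refl B c * T) a ≠ a ∧
            B ((refl B c * T) a - a) ((refl B c * T) a - a) = 0 := by
          intro h
          have := (bad_case B hsym hnd F hF _ h1 h2 c hc hcc h).1
          linarith
        push Not at hgood
        obtain ⟨a, ha, haa, hx⟩ := hgood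
        obtain ⟨k, hk, hp⟩ := step2 _ h1 h2 a ha haa (fun h => hx h.1 h.2)
        have hodd : k ≠ 2 * m := by
          rintro rfl
          have := hp.det
          rw [hdet', pow_mul] at this
          norm_num at this
          linarith
        exact ⟨k + 1, by omega, hp.cons _ hcc⟩
      · push Not at hbad
        obtain ⟨a, ha, haa, hx⟩ := hbad
        exact step2 T hT hfix a ha haa (fun h => hx h.1 h.2)
    · push Not at hex
      have hbot : ∀ w ∈ B.orthogonal F, w = 0 := by
        intro w hw
        apply hnd.1
        intro y
        obtain ⟨f, hf, v, hv, rfl⟩ := dec y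
        have h := hex _ (Submodule.add_mem _ hw hv)
        simp only [map_add, LinearMap.add_apply, hex w hw, hex v hv, hsym v w] at h
        have h' : B w f = 0 := by rw [hsym]; exact hw f hf
        rw [map_add, h']
        linarith
      refine ⟨0, by simpa using Submodule.finrank_le F, [], rfl, by simp, ?_⟩
      ext x
      obtain ⟨f, hf, v, hv, rfl⟩ := dec x
      rw [hbot v hv]
      simpa using hfix f hf

end CD

theorem Bpq_apply (p q : ℕ) (x y : Fin (p + q) → ℝ) : Bpq p q x y =
    ∑ i : Fin (p + q), (if i.val < p then (1 : ℝ) else -1) * (x i * y i) := rfl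

theorem Bpq_symm (p q : ℕ) (x y : Fin (p + q) → ℝ) : Bpq p q x y = Bpq p q y x := by
  simp only [Bpq_apply, mul_comm]

theorem Bpq_left (p q : ℕ) (x : Fin (p + q) → ℝ) (h : ∀ y, Bpq p q x y = 0) : x = 0 := by
  funext i
  have := h (Pi.single i 1)
  rw [Bpq_apply, Finset.sum_eq_single i] at this
  · by_cases hi : i.val < p <;> simpa [hi] using this
  · intro j _ hj
    simp [hj]
  · simp

theorem Bpq_nondeg (p q : ℕ) : (Bpq p q).Nondegenerate :=
  ⟨Bpq_left p q, fun y h => Bpq_left p q y (fun x => by rw [Bpq_symm]; exact h x)⟩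

theorem refl_eq (p q : ℕ) (s : Fin (p + q) → ℝ) : ⇑(CD.refl (Bpq p q) s) = reflpq p q s := by
  funext x
  rw [CD.refl_apply, reflpq, Bpq_symm p q x s, sub_eq_add_neg, ← neg_smul]
  congr 2
  ring

/-- Cartan–Dieudonné: every orthogonal transformation of `ℝ^{p,q}` is
the composition of at most `p + q` hyperplane reflections (the empty composition
being the identity). -/
theorem stmt_8 (p q : ℕ) (T : (Fin (p + q) → ℝ) →ₗ[ℝ] (Fin (p + q) → ℝ))
    (horth : ∀ x y : Fin (p + q) → ℝ, Bpq p q (T x) (T y) = Bpq p q x y) :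
    ∃ (k : ℕ) (s : Fin k → (Fin (p + q) → ℝ)), k ≤ p + q ∧
      (∀ i, Bpq p q (s i) (s i) ≠ 0) ∧
      ⇑T = (List.ofFn fun i => reflpq p q (s i)).foldr (· ∘ ·) id := by
  obtain ⟨k, hk, l, rfl, hl, hT⟩ := CD.main (Bpq p q) (Bpq_symm p q) (Bpq_nondeg p q) _ ⊥
    disjoint_bot_left le_rfl T horth (by intro x hx; rw [(Submodule.mem_bot ℝ).1 hx, map_zero])
  refine ⟨l.length, l.get, by simpa using hk, fun i => hl _ (List.get_mem l i), ?_⟩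
  have h1 : (List.ofFn fun i => reflpq p q (l.get i)) = l.map (reflpq p q) := by
    conv_rhs => rw [← List.ofFn_get l, List.map_ofFn]
    rfl
  rw [h1, hT]
  clear h1 hT hl hk
  induction l with
  | nil => rfl
  | cons a l ih =>
    rw [List.map_cons, List.prod_cons, List.map_cons, List.foldr_cons, ← ih, ← refl_eq]
    rfl
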